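/- Suppose T and S are term distributions with T ≃^T S. Then: (i) if T ⇛ T' then T' ≃^T S; (ii) if T ↦^{pass(v)} T' and S ↦^{pass(v)} S' then T' ≃^T S'; (iii) if T ↦^{view(m)} p then S ↦^{view(m)} p. -/

import Mathlib

set_option autoImplicit false
set_option maxHeartbeats 1000000

open scoped Classical ENNReal

/-! ### Syntax of RSLR -/

/-- Binary strings. -/
abbrev BStr := List Bool

/-- Aspects. -/
inductive Aspect : Type
  | box | bbox
deriving DecidableEq

/-- Types of RSLR: `Str` and aspect-annotated arrows. -/
inductive Ty : Type
  | str : Ty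
  | arrow : Aspect → Ty → Ty → Ty
deriving DecidableEq

/-- The order on aspects: `□ <: □`, `□ <: ■`, `■ <: ■`. -/
inductive AspectLe : Aspect → Aspect → Prop
  | boxBox : AspectLe .box .box
  | boxBBox : AspectLe .box .bbox
  | bboxBBox : AspectLe .bbox .bbox

/-- Subtyping of RSLR types. -/
inductive SubTy : Ty → Ty → Prop
  | refl (A : Ty) : SubTy A A
  | trans {A B C : Ty} : SubTy A B → SubTy B C → SubTy A C
  | arrow {A B C D : Ty} {a b : Aspect} :
      SubTy B A → SubTy C D → AspectLe a b → SubTy (.arrow a A C) (.arrow b B D)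

/-- A type is `□`-free when no `□` aspect occurs in it. -/
def Ty.boxFree : Ty → Prop
  | .str => True
  | .arrow a A B => a = .bbox ∧ A.boxFree ∧ B.boxFree

/-- Terms of RSLR. -/
inductive Tm : Type
  | var : ℕ → Tm
  | str : BStr → Tm
  | lam : ℕ → Aspect → Ty → Tm → Tm
  | app : Tm → Tm → Tm
  | zero : Tm → Tm
  | one : Tm → Tm
  | tail : Tm → Tm
  | tcase : Ty → Tm → Tm → Tm → Tm → Tm
  | trec : Ty → Tm → Tm → Tm → Tm → Tm
  | rand : Tm
deriving DecidableEq

/-- Values: string constants and abstractions. -/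
def IsValue : Tm → Prop
  | .str _ => True
  | .lam _ _ _ _ => True
  | _ => False

/-- Substitution of a (closed) term `v` for the variable `x`. -/
def tsubst (v : Tm) (x : ℕ) : Tm → Tm
  | .var y => if y = x then v else .var y
  | .str m => .str m
  | .lam y a A t => if y = x then .lam y a A t else .lam y a A (tsubst v x t)
  | .app t s => .app (tsubst v x t) (tsubst v x s)
  | .zero t => .zero (tsubst v x t)
  | .one t => .one (tsubst v x t)
  | .tail t => .tail (tsubst v x t)
  | .tcase A t t0 t1 te => .tcase A (tsubst v x t) (tsubst v x t0) (tsubst v x t1) (tsubst v x te)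
  | .trec A t t0 t1 te => .trec A (tsubst v x t) (tsubst v x t0) (tsubst v x t1) (tsubst v x te)
  | .rand => .rand

/-- Typing contexts: assignments of an aspect and a type to variables. -/
abbrev TyCtx := List (ℕ × Aspect × Ty)

/-- The typing judgment `Γ ⊢ t : A` of RSLR. -/
inductive HasType : TyCtx → Tm → Ty → Prop
  | var {Γ : TyCtx} {x : ℕ} {a : Aspect} {A : Ty} :
      (x, a, A) ∈ Γ → HasType Γ (Tm.var x) A
  | str {Γ : TyCtx} {m : BStr} : HasType Γ (Tm.str m) Ty.str
  | rand {Γ : TyCtx} : HasType Γ Tm.rand Ty.str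
  | zero {Γ : TyCtx} {t : Tm} : HasType Γ t Ty.str → HasType Γ (Tm.zero t) Ty.str
  | one {Γ : TyCtx} {t : Tm} : HasType Γ t Ty.str → HasType Γ (Tm.one t) Ty.str
  | tail {Γ : TyCtx} {t : Tm} : HasType Γ t Ty.str → HasType Γ (Tm.tail t) Ty.str
  | lam {Γ : TyCtx} {x : ℕ} {a : Aspect} {A B : Ty} {t : Tm} :
      HasType ((x, a, A) :: Γ) t B → HasType Γ (Tm.lam x a A t) (Ty.arrow a A B)
  | app {Γ : TyCtx} {a : Aspect} {A B : Ty} {t s : Tm} :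
      HasType Γ t (Ty.arrow a A B) → HasType Γ s A → HasType Γ (Tm.app t s) B
  | tcase {Γ : TyCtx} {A : Ty} {t t0 t1 te : Tm} :
      HasType Γ t Ty.str → HasType Γ t0 A → HasType Γ t1 A → HasType Γ te A →
      HasType Γ (Tm.tcase A t t0 t1 te) A
  | trec {Γ : TyCtx} {A : Ty} {t t0 t1 te : Tm} :
      HasType Γ t Ty.str →
      HasType Γ t0 (Ty.arrow .box Ty.str (Ty.arrow .bbox A A)) →
      HasType Γ t1 (Ty.arrow .box Ty.str (Ty.arrow .bbox A A)) →
      HasType Γ te A → A.boxFree → HasType Γ (Tm.trec A t t0 t1 te) A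
  | sub {Γ : TyCtx} {t : Tm} {A B : Ty} : HasType Γ t A → SubTy A B → HasType Γ t B

/-! ### Big-step (distribution) semantics -/

/-- The distribution `{0^{1/2}, 1^{1/2}}` produced by `rand`. -/
noncomputable def randPMF : PMF Tm := (PMF.uniformOfFintype Bool).map (fun b => Tm.str [b])

/-- Prepend a bit to a string value. -/
def consBit (b : Bool) : Tm → Tm
  | .str m => .str (b :: m)
  | t => t

/-- Tail of a string value (`tail ε = ε`). -/
def tailFn : Tm → Tm
  | .str (_ :: m) => .str m
  | t => t

/-- β-application of a value to an abstraction. -/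
def applyLam (v : Tm) : Tm → Tm
  | .lam x _ _ t => tsubst v x t
  | t => t

/-- Selection of the branch distribution in a `case`, by the evaluated scrutinee. -/
noncomputable def caseRes (D0 D1 De : PMF Tm) : Tm → PMF Tm
  | .str [] => De
  | .str (false :: _) => D0
  | .str (true :: _) => D1
  | v => PMF.pure v

/-- Selection of the continuation distribution in a `rec`, by the evaluated scrutinee. -/
noncomputable def recRes (De : PMF Tm) (F : Bool → BStr → PMF Tm) : Tm → PMF Tm
  | .str [] => De
  | .str (b :: n) => F b n
  | v => PMF.pure v

/-- The big-step semantics `t ⇓ D` of RSLR, relating closed terms to value distributions. -/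
inductive BigStep : Tm → PMF Tm → Prop
  | val {v : Tm} : IsValue v → BigStep v (PMF.pure v)
  | rand : BigStep Tm.rand randPMF
  | zero {t : Tm} {D : PMF Tm} : BigStep t D → BigStep (Tm.zero t) (D.map (consBit false))
  | one {t : Tm} {D : PMF Tm} : BigStep t D → BigStep (Tm.one t) (D.map (consBit true))
  | tail {t : Tm} {D : PMF Tm} : BigStep t D → BigStep (Tm.tail t) (D.map tailFn)
  | app {t s : Tm} {D E : PMF Tm} {F : Tm → Tm → PMF Tm} :
      BigStep t D → BigStep s E →
      (∀ f ∈ D.support, ∀ v ∈ E.support, BigStep (applyLam v f) (F f v)) →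
      BigStep (Tm.app t s) (D.bind fun f => E.bind fun v => F f v)
  | tcase {A : Ty} {t t0 t1 te : Tm} {D D0 D1 De : PMF Tm} :
      BigStep t D → BigStep t0 D0 → BigStep t1 D1 → BigStep te De →
      BigStep (Tm.tcase A t t0 t1 te) (D.bind (caseRes D0 D1 De))
  | trec {A : Ty} {t t0 t1 te : Tm} {D De : PMF Tm} {F : Bool → BStr → PMF Tm} :
      BigStep t D → BigStep te De →
      (∀ (b : Bool) (n : BStr), Tm.str (b :: n) ∈ D.support →
        BigStep (Tm.app (Tm.app (if b then t1 else t0) (Tm.str (b :: n)))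
          (Tm.trec A (Tm.str n) t0 t1 te)) (F b n)) →
      BigStep (Tm.trec A t t0 t1 te) (D.bind (recRes De F))

/-- `⟦t⟧`: the distribution of `t` (chosen via the big-step semantics). -/
noncomputable def sem (t : Tm) : PMF Tm :=
  if h : ∃ D : PMF Tm, BigStep t D then h.choose else PMF.pure t

/-! ### Small-step semantics on terms and term distributions -/

/-- Dispatch of a `case` on the leading bit of the scrutinee. -/
def caseDispatch (t0 t1 te : Tm) : BStr → Tm
  | [] => te
  | false :: _ => t0
  | true :: _ => t1

/-- Unfolding of a `rec` on the leading bit of the scrutinee. -/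
def recDispatch (A : Ty) (t0 t1 te : Tm) : BStr → Tm
  | [] => te
  | b :: n => Tm.app (Tm.app (if b then t1 else t0) (Tm.str (b :: n))) (Tm.trec A (Tm.str n) t0 t1 te)

/-- One-step (probabilistic) reduction `t → {tᵢ^{pᵢ}}` on terms. -/
inductive Step : Tm → PMF Tm → Prop
  | beta {x : ℕ} {a : Aspect} {A : Ty} {t v : Tm} :
      IsValue v → Step (Tm.app (Tm.lam x a A t) v) (PMF.pure (tsubst v x t))
  | rand : Step Tm.rand randPMF
  | zeroV {m : BStr} : Step (Tm.zero (Tm.str m)) (PMF.pure (Tm.str (false :: m)))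
  | oneV {m : BStr} : Step (Tm.one (Tm.str m)) (PMF.pure (Tm.str (true :: m)))
  | tailV {m : BStr} : Step (Tm.tail (Tm.str m)) (PMF.pure (tailFn (Tm.str m)))
  | caseV {A : Ty} {m : BStr} {t0 t1 te : Tm} :
      Step (Tm.tcase A (Tm.str m) t0 t1 te) (PMF.pure (caseDispatch t0 t1 te m))
  | trecV {A : Ty} {m : BStr} {t0 t1 te : Tm} :
      Step (Tm.trec A (Tm.str m) t0 t1 te) (PMF.pure (recDispatch A t0 t1 te m))
  | appL {t s : Tm} {D : PMF Tm} : Step t D → Step (Tm.app t s) (D.map fun t' => Tm.app t' s)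
  | appR {v s : Tm} {D : PMF Tm} :
      IsValue v → Step s D → Step (Tm.app v s) (D.map fun s' => Tm.app v s')
  | zeroC {t : Tm} {D : PMF Tm} : Step t D → Step (Tm.zero t) (D.map Tm.zero)
  | oneC {t : Tm} {D : PMF Tm} : Step t D → Step (Tm.one t) (D.map Tm.one)
  | tailC {t : Tm} {D : PMF Tm} : Step t D → Step (Tm.tail t) (D.map Tm.tail)
  | caseC {A : Ty} {t t0 t1 te : Tm} {D : PMF Tm} :
      Step t D → Step (Tm.tcase A t t0 t1 te) (D.map fun t' => Tm.tcase A t' t0 t1 te)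
  | trecC {A : Ty} {t t0 t1 te : Tm} {D : PMF Tm} :
      Step t D → Step (Tm.trec A t t0 t1 te) (D.map fun t' => Tm.trec A t' t0 t1 te)

/-- Internal reduction `T ⇛ T'` of term distributions: one term of the support
makes one reduction step. -/
def IntStep (T T' : PMF Tm) : Prop :=
  ∃ t ∈ T.support, ∃ D : PMF Tm, Step t D ∧
    T' = T.bind fun s => if s = t then D else PMF.pure s

/-- A term distribution all of whose support consists of abstractions. -/
def IsLamD (T : PMF Tm) : Prop := ∀ t ∈ T.support, ∃ x a A b, t = Tm.lam x a A b

/-- A term distribution all of whose support consists of string constants. -/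
def IsStrD (T : PMF Tm) : Prop := ∀ t ∈ T.support, ∃ m : BStr, t = Tm.str m

/-! ### Linear contexts -/

/-- Linear contexts: terms with (at most) one hole, lying outside any recursion
(the hole may appear as the scrutinee of a `rec`, but not inside its branches). -/
inductive Cx : Type
  | hole : Cx
  | term : Tm → Cx
  | lam : ℕ → Aspect → Ty → Cx → Cx
  | appL : Cx → Tm → Cx
  | appR : Tm → Cx → Cx
  | zero : Cx → Cx
  | one : Cx → Cx
  | tail : Cx → Cx
  | caseS : Ty → Cx → Tm → Tm → Tm → Cx
  | case0 : Ty → Tm → Cx → Tm → Tm → Cx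
  | case1 : Ty → Tm → Tm → Cx → Tm → Cx
  | caseE : Ty → Tm → Tm → Tm → Cx → Cx
  | recS : Ty → Cx → Tm → Tm → Tm → Cx

/-- `C[t]`: filling the hole of a context with a term. -/
def Cx.fill : Cx → Tm → Tm
  | .hole, u => u
  | .term t, _ => t
  | .lam x a A C, u => Tm.lam x a A (C.fill u)
  | .appL C t, u => Tm.app (C.fill u) t
  | .appR t C, u => Tm.app t (C.fill u)
  | .zero C, u => Tm.zero (C.fill u)
  | .one C, u => Tm.one (C.fill u)
  | .tail C, u => Tm.tail (C.fill u)
  | .caseS A C t0 t1 te, u => Tm.tcase A (C.fill u) t0 t1 te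
  | .case0 A t C t1 te, u => Tm.tcase A t (C.fill u) t1 te
  | .case1 A t t0 C te, u => Tm.tcase A t t0 (C.fill u) te
  | .caseE A t t0 t1 C, u => Tm.tcase A t t0 t1 (C.fill u)
  | .recS A C t0 t1 te, u => Tm.trec A (C.fill u) t0 t1 te

/-- Context typing `⊢ C[⊢A] : B`: for every closed `t : A`, `⊢ C[t] : B`. -/
def CxTy (C : Cx) (A B : Ty) : Prop :=
  ∀ t : Tm, HasType [] t A → HasType [] (C.fill t) B

/-- `C[T]`: filling a context with every term of a term distribution. -/
noncomputable def Cx.fillD (C : Cx) (T : PMF Tm) : PMF Tm := T.map C.fill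

/-- Whether a context actually contains the hole. -/
def Cx.hasHole : Cx → Bool
  | .hole => true
  | .term _ => false
  | .lam _ _ _ C => C.hasHole
  | .appL C _ => C.hasHole
  | .appR _ C => C.hasHole
  | .zero C => C.hasHole
  | .one C => C.hasHole
  | .tail C => C.hasHole
  | .caseS _ C _ _ _ => C.hasHole
  | .case0 _ _ C _ _ => C.hasHole
  | .case1 _ _ _ C _ => C.hasHole
  | .caseE _ _ _ _ C => C.hasHole
  | .recS _ C _ _ _ => C.hasHole

/-- Substitution of a value for a variable inside a context. -/
def Cx.substV (v : Tm) (x : ℕ) : Cx → Cx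
  | .hole => .hole
  | .term t => .term (tsubst v x t)
  | .lam y a A C => if y = x then .lam y a A C else .lam y a A (C.substV v x)
  | .appL C t => .appL (C.substV v x) (tsubst v x t)
  | .appR t C => .appR (tsubst v x t) (C.substV v x)
  | .zero C => .zero (C.substV v x)
  | .one C => .one (C.substV v x)
  | .tail C => .tail (C.substV v x)
  | .caseS A C t0 t1 te =>
      .caseS A (C.substV v x) (tsubst v x t0) (tsubst v x t1) (tsubst v x te)
  | .case0 A t C t1 te =>
      .case0 A (tsubst v x t) (C.substV v x) (tsubst v x t1) (tsubst v x te)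
  | .case1 A t t0 C te =>
      .case1 A (tsubst v x t) (tsubst v x t0) (C.substV v x) (tsubst v x te)
  | .caseE A t t0 t1 C =>
      .caseE A (tsubst v x t) (tsubst v x t0) (tsubst v x t1) (C.substV v x)
  | .recS A C t0 t1 te =>
      .recS A (C.substV v x) (tsubst v x t0) (tsubst v x t1) (tsubst v x te)

/-- Occurrence check for a variable in a term. -/
def occurs (x : ℕ) : Tm → Bool
  | .var y => y = x
  | .str _ => false
  | .lam y _ _ t => if y = x then false else occurs x t
  | .app t s => occurs x t || occurs x s
  | .zero t => occurs x t
  | .one t => occurs x t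
  | .tail t => occurs x t
  | .tcase _ t t0 t1 te => occurs x t || occurs x t0 || occurs x t1 || occurs x te
  | .trec _ t t0 t1 te => occurs x t || occurs x t0 || occurs x t1 || occurs x te
  | .rand => false

/-- `t{C/x}`: substitution of a context for a (linearly occurring) variable in a term,
yielding a context. -/
def substCx (C : Cx) (x : ℕ) : Tm → Cx
  | .var y => if y = x then C else .term (.var y)
  | .str m => .term (.str m)
  | .lam y a A t =>
      if y = x then .term (.lam y a A t)
      else if occurs x t then .lam y a A (substCx C x t) else .term (.lam y a A t)
  | .app t s =>
      if occurs x t then .appL (substCx C x t) s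
      else if occurs x s then .appR t (substCx C x s)
      else .term (.app t s)
  | .zero t => if occurs x t then .zero (substCx C x t) else .term (.zero t)
  | .one t => if occurs x t then .one (substCx C x t) else .term (.one t)
  | .tail t => if occurs x t then .tail (substCx C x t) else .term (.tail t)
  | .tcase A t t0 t1 te =>
      if occurs x t then .caseS A (substCx C x t) t0 t1 te
      else if occurs x t0 then .case0 A t (substCx C x t0) t1 te
      else if occurs x t1 then .case1 A t t0 (substCx C x t1) te
      else if occurs x te then .caseE A t t0 t1 (substCx C x te)
      else .term (.tcase A t t0 t1 te)
  | .trec A t t0 t1 te =>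
      if occurs x t then .recS A (substCx C x t) t0 t1 te
      else .term (.trec A t t0 t1 te)
  | .rand => .term .rand

/-- The string observed from a normal context pair: the value produced by a context
whose result is of base type, given the term filling the hole. -/
def obs : Cx → Tm → Option BStr
  | .hole, .str m => some m
  | .term (.str m), _ => some m
  | .zero C, t => (obs C t).map (fun m => false :: m)
  | .one C, t => (obs C t).map (fun m => true :: m)
  | .tail C, t => (obs C t).map List.tail
  | _, _ => none

/-! ### Context pairs and their reduction -/

/-- A context pair `(C, T)` is a value when every filling produces a value. -/
def PairVal (C : Cx) (T : PMF Tm) : Prop := ∀ t ∈ T.support, IsValue (C.fill t)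

/-- A context pair producing a string observation on all of its support. -/
def StrObs (C : Cx) (T : PMF Tm) : Prop := ∀ t ∈ T.support, ∃ m : BStr, obs C t = some m

/-- The `pass`-action on context pairs: either the hole (filled with a distribution of
abstractions) or a λ-context receives the value. -/
inductive PairPass : Cx × PMF Tm → Tm → Cx × PMF Tm → Prop
  | hole {T : PMF Tm} {v : Tm} :
      IsLamD T → PairPass (Cx.hole, T) v (Cx.hole, T.map (applyLam v))
  | lam {x : ℕ} {a : Aspect} {A : Ty} {C : Cx} {T : PMF Tm} {v : Tm} :
      PairPass (Cx.lam x a A C, T) v (C.substV v x, T)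

/-- Dispatch of a `case` whose first branch holds the hole. -/
def case0Disp (C0 : Cx) (t1 te : Tm) : BStr → Cx
  | [] => .term te
  | false :: _ => C0
  | true :: _ => .term t1

/-- Dispatch of a `case` whose second branch holds the hole. -/
def case1Disp (t0 : Tm) (C1 : Cx) (te : Tm) : BStr → Cx
  | [] => .term te
  | false :: _ => .term t0
  | true :: _ => C1

/-- Dispatch of a `case` whose third branch holds the hole. -/
def caseEDisp (t0 t1 : Tm) (Ce : Cx) : BStr → Cx
  | [] => Ce
  | false :: _ => .term t0
  | true :: _ => .term t1

/-- One-step internal reduction of context pairs: either the context reduces, or the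
term distribution in the hole reduces, or the context consumes the observation of
the hole (in a `case` or `rec` scrutinee position). -/
inductive PairStep : Cx × PMF Tm → PMF (Cx × PMF Tm) → Prop
  | term {t : Tm} {D : PMF Tm} {T : PMF Tm} :
      Step t D → PairStep (Cx.term t, T) (D.map fun t' => (Cx.term t', T))
  | holeInt {T T' : PMF Tm} :
      IntStep T T' → PairStep (Cx.hole, T) (PMF.pure (Cx.hole, T'))
  | appPass {C : Cx} {T : PMF Tm} {v : Tm} {c' : Cx × PMF Tm} :
      IsValue v → PairPass (C, T) v c' → PairStep (Cx.appL C v, T) (PMF.pure c')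
  | appLC {C : Cx} {t : Tm} {T : PMF Tm} {P : PMF (Cx × PMF Tm)} :
      PairStep (C, T) P → PairStep (Cx.appL C t, T) (P.map fun c => (Cx.appL c.1 t, c.2))
  | appLArg {C : Cx} {T : PMF Tm} {t : Tm} {D : PMF Tm} :
      PairVal C T → Step t D →
      PairStep (Cx.appL C t, T) (D.map fun t' => (Cx.appL C t', T))
  | appRC {v : Tm} {C : Cx} {T : PMF Tm} {P : PMF (Cx × PMF Tm)} :
      IsValue v → PairStep (C, T) P →
      PairStep (Cx.appR v C, T) (P.map fun c => (Cx.appR v c.1, c.2))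
  | appRFun {t : Tm} {C : Cx} {T : PMF Tm} {D : PMF Tm} :
      Step t D → PairStep (Cx.appR t C, T) (D.map fun t' => (Cx.appR t' C, T))
  | betaArg {x : ℕ} {a : Aspect} {A : Ty} {t : Tm} {C : Cx} {T : PMF Tm} :
      PairVal C T →
      PairStep (Cx.appR (Tm.lam x a A t) C, T) (PMF.pure (substCx C x t, T))
  | zeroC {C : Cx} {T : PMF Tm} {P : PMF (Cx × PMF Tm)} :
      PairStep (C, T) P → PairStep (Cx.zero C, T) (P.map fun c => (Cx.zero c.1, c.2))
  | oneC {C : Cx} {T : PMF Tm} {P : PMF (Cx × PMF Tm)} :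
      PairStep (C, T) P → PairStep (Cx.one C, T) (P.map fun c => (Cx.one c.1, c.2))
  | tailC {C : Cx} {T : PMF Tm} {P : PMF (Cx × PMF Tm)} :
      PairStep (C, T) P → PairStep (Cx.tail C, T) (P.map fun c => (Cx.tail c.1, c.2))
  | zeroV {m : BStr} {T : PMF Tm} :
      PairStep (Cx.zero (Cx.term (Tm.str m)), T)
        (PMF.pure (Cx.term (Tm.str (false :: m)), T))
  | oneV {m : BStr} {T : PMF Tm} :
      PairStep (Cx.one (Cx.term (Tm.str m)), T)
        (PMF.pure (Cx.term (Tm.str (true :: m)), T))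
  | tailV {m : BStr} {T : PMF Tm} :
      PairStep (Cx.tail (Cx.term (Tm.str m)), T)
        (PMF.pure (Cx.term (tailFn (Tm.str m)), T))
  | caseSC {A : Ty} {C : Cx} {t0 t1 te : Tm} {T : PMF Tm} {P : PMF (Cx × PMF Tm)} :
      PairStep (C, T) P →
      PairStep (Cx.caseS A C t0 t1 te, T) (P.map fun c => (Cx.caseS A c.1 t0 t1 te, c.2))
  | caseSDisp {A : Ty} {C : Cx} {T : PMF Tm} {t0 t1 te : Tm} :
      StrObs C T →
      PairStep (Cx.caseS A C t0 t1 te, T)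
        (T.map fun t => (Cx.term (caseDispatch t0 t1 te ((obs C t).getD [])), T))
  | case0Scrut {A : Ty} {t : Tm} {C0 : Cx} {t1 te : Tm} {D : PMF Tm} {T : PMF Tm} :
      Step t D →
      PairStep (Cx.case0 A t C0 t1 te, T) (D.map fun t' => (Cx.case0 A t' C0 t1 te, T))
  | case0V {A : Ty} {m : BStr} {C0 : Cx} {t1 te : Tm} {T : PMF Tm} :
      PairStep (Cx.case0 A (Tm.str m) C0 t1 te, T) (PMF.pure (case0Disp C0 t1 te m, T))
  | case1Scrut {A : Ty} {t t0 : Tm} {C1 : Cx} {te : Tm} {D : PMF Tm} {T : PMF Tm} :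
      Step t D →
      PairStep (Cx.case1 A t t0 C1 te, T) (D.map fun t' => (Cx.case1 A t' t0 C1 te, T))
  | case1V {A : Ty} {m : BStr} {t0 : Tm} {C1 : Cx} {te : Tm} {T : PMF Tm} :
      PairStep (Cx.case1 A (Tm.str m) t0 C1 te, T) (PMF.pure (case1Disp t0 C1 te m, T))
  | caseEScrut {A : Ty} {t t0 t1 : Tm} {Ce : Cx} {D : PMF Tm} {T : PMF Tm} :
      Step t D →
      PairStep (Cx.caseE A t t0 t1 Ce, T) (D.map fun t' => (Cx.caseE A t' t0 t1 Ce, T))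
  | caseEV {A : Ty} {m : BStr} {t0 t1 : Tm} {Ce : Cx} {T : PMF Tm} :
      PairStep (Cx.caseE A (Tm.str m) t0 t1 Ce, T) (PMF.pure (caseEDisp t0 t1 Ce m, T))
  | recSC {A : Ty} {C : Cx} {t0 t1 te : Tm} {T : PMF Tm} {P : PMF (Cx × PMF Tm)} :
      PairStep (C, T) P →
      PairStep (Cx.recS A C t0 t1 te, T) (P.map fun c => (Cx.recS A c.1 t0 t1 te, c.2))
  | recSDisp {A : Ty} {C : Cx} {T : PMF Tm} {t0 t1 te : Tm} :
      StrObs C T →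
      PairStep (Cx.recS A C t0 t1 te, T)
        (T.map fun t => (Cx.term (recDispatch A t0 t1 te ((obs C t).getD [])), T))

/-- Internal reduction `P ⇛ P'` of (context) pair distributions. -/
def PIntStep (P P' : PMF (Cx × PMF Tm)) : Prop :=
  ∃ c ∈ P.support, ∃ Q : PMF (Cx × PMF Tm), PairStep c Q ∧
    P' = P.bind fun d => if d = c then Q else PMF.pure d

/-- A pair distribution is normal when every filling of every pair in its support
is a value. -/
def PNormal (P : PMF (Cx × PMF Tm)) : Prop :=
  ∀ c ∈ P.support, ∀ t ∈ c.2.support, IsValue (Cx.fill c.1 t)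

/-! ### Traces and trace equivalence -/

/-- Actions: passing a value, or viewing a string. -/
inductive Act : Type
  | pass : Tm → Act
  | view : BStr → Act

/-- Traces: finite sequences of actions. -/
abbrev Trace := List Act

/-- Labeled small-step reduction of term distributions along the `pass`-actions of a
trace, interleaved with internal reduction. -/
inductive TraceStep : PMF Tm → Trace → PMF Tm → Prop
  | refl (T : PMF Tm) : TraceStep T [] T
  | internal {T : PMF Tm} {S : Trace} {T' T'' : PMF Tm} :
      TraceStep T S T' → IntStep T' T'' → TraceStep T S T''
  | pass {T : PMF Tm} {S : Trace} {T' : PMF Tm} {v : Tm} :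
      TraceStep T S T' → IsLamD T' →
      TraceStep T (S ++ [Act.pass v]) (T'.map (applyLam v))

/-- `T ↦^S p`: the probability that a term distribution accepts a trace ending with a
`view`-action. -/
inductive TraceAcc : PMF Tm → Trace → ℝ → Prop
  | view {T : PMF Tm} {S : Trace} {T' : PMF Tm} {m : BStr} :
      TraceStep T S T' → IsStrD T' →
      TraceAcc T (S ++ [Act.view m]) ((T' (Tm.str m)).toReal)

/-- `Pr(T, S)`, the probability that `T` accepts the trace `S`. -/
noncomputable def prT (T : PMF Tm) (S : Trace) : ℝ :=
  if h : ∃ p : ℝ, TraceAcc T S p then h.choose else 0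

/-- Trace equivalence `T ≃^T S` of term distributions. -/
def TrEq (T S : PMF Tm) : Prop := ∀ tr : Trace, prT T tr = prT S tr

/-- Trace equivalence of terms: `t ≃ s` iff `{t¹} ≃^T {s¹}`. -/
def TmTrEq (t s : Tm) : Prop := TrEq (PMF.pure t) (PMF.pure s)

/-- Compatibility of a trace with a type. -/
inductive Compat : Trace → Ty → Prop
  | str (m : BStr) : Compat [Act.view m] Ty.str
  | arrow {a : Aspect} {A B : Ty} {v : Tm} {S : Trace} :
      IsValue v → HasType [] v A → Compat S B →
      Compat (Act.pass v :: S) (Ty.arrow a A B)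

/-- Context equivalence `t ≡ s` of closed terms of type `A`. -/
def CtxEq (A : Ty) (t s : Tm) : Prop :=
  ∀ C : Cx, CxTy C A Ty.str → sem (C.fill t) (Tm.str []) = sem (C.fill s) (Tm.str [])

/-- The probability that a (normal) context pair exhibits the string `m`. -/
noncomputable def pairView (C : Cx) (T : PMF Tm) (m : BStr) : ℝ :=
  (∑' t : Tm, if obs C t = some m then T t else 0).toReal

/-- Labeled small-step reduction of pair distributions along the `pass`-actions of a
trace, interleaved with internal reduction. -/
inductive PTraceStep : PMF (Cx × PMF Tm) → Trace → PMF (Cx × PMF Tm) → Prop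
  | refl (P : PMF (Cx × PMF Tm)) : PTraceStep P [] P
  | internal {P : PMF (Cx × PMF Tm)} {S : Trace} {P' P'' : PMF (Cx × PMF Tm)} :
      PTraceStep P S P' → PIntStep P' P'' → PTraceStep P S P''
  | pass {P : PMF (Cx × PMF Tm)} {S : Trace} {P' : PMF (Cx × PMF Tm)} {v : Tm}
      (f : Cx × PMF Tm → Cx × PMF Tm) :
      PTraceStep P S P' → (∀ c ∈ P'.support, PairPass c v (f c)) →
      PTraceStep P (S ++ [Act.pass v]) (P'.map f)

/-- `P ↦^S p`: trace acceptance probability for pair distributions. -/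
inductive PTraceAcc : PMF (Cx × PMF Tm) → Trace → ℝ → Prop
  | view {P : PMF (Cx × PMF Tm)} {S : Trace} {P' : PMF (Cx × PMF Tm)} {m : BStr} :
      PTraceStep P S P' →
      PTraceAcc P (S ++ [Act.view m])
        (∑' c : Cx × PMF Tm, (P' c).toReal * pairView c.1 c.2 m)

/-- Trace relatedness `P ▽ Q`: the two pair distributions are given by families with
the same contexts and weights, and pointwise trace-equivalent term distributions. -/
def TraceRel (P Q : PMF (Cx × PMF Tm)) : Prop :=
  ∃ (I : Type) (C : I → Cx) (T S : I → PMF Tm) (p : I → ℝ≥0∞),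
    (∀ i, TrEq (T i) (S i)) ∧
    (∀ c, P c = ∑' i, if c = (C i, T i) then p i else 0) ∧
    (∀ c, Q c = ∑' i, if c = (C i, S i) then p i else 0)

/-! ### Determinism of one-step reduction -/

theorem not_step_of_isValue {v : Tm} {D : PMF Tm} (hv : IsValue v) (h : Step v D) : False := by
  cases h <;> simp [IsValue] at hv

theorem Step.unique {t : Tm} {D E : PMF Tm} (h : Step t D) (h' : Step t E) : D = E := by
  induction h generalizing E with
  | beta hv =>
    cases h' with
    | beta => rfl
    | appL h => exact (not_step_of_isValue (by simp [IsValue]) h).elim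
    | appR _ h => exact (not_step_of_isValue hv h).elim
  | rand => cases h'; rfl
  | zeroV | oneV | tailV | caseV | trecV =>
    cases h' <;> first
      | rfl
      | exact (not_step_of_isValue (v := Tm.str _) trivial (by assumption)).elim
  | appL h ih =>
    cases h' with
    | beta => exact (not_step_of_isValue (by simp [IsValue]) h).elim
    | appL h' => rw [ih h']
    | appR hv _ => exact (not_step_of_isValue hv h).elim
  | appR hv h ih =>
    cases h' with
    | beta hw => exact (not_step_of_isValue hw h).elim
    | appL h' => exact (not_step_of_isValue hv h').elim
    | appR _ h' => rw [ih h']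
  | zeroC h ih | oneC h ih | tailC h ih | caseC h ih | trecC h ih =>
    cases h' <;> first
      | exact (not_step_of_isValue (v := Tm.str _) trivial h).elim
      | (rename_i h'; rw [ih h'])

theorem Step.finite_support {t : Tm} {D : PMF Tm} (h : Step t D) : D.support.Finite := by
  induction h with
  | rand =>
    rw [randPMF, PMF.support_map]
    exact (Set.toFinite _).image _
  | beta | zeroV | oneV | tailV | caseV | trecV =>
    rw [PMF.support_pure]
    exact Set.finite_singleton _
  | appL _ ih | appR _ _ ih | zeroC _ ih | oneC _ ih | tailC _ ih | caseC _ ih | trecC _ ih =>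
    rw [PMF.support_map]
    exact ih.image _

/-! ### Iterated small-step evaluation of terms -/

/-- `SmallEval t D`: every reduction path of `t` ends in a value, and `D` is the resulting
value distribution. -/
inductive SmallEval : Tm → PMF Tm → Prop
  | val {v : Tm} : IsValue v → SmallEval v (PMF.pure v)
  | step {t : Tm} {D : PMF Tm} {F : Tm → PMF Tm} :
      Step t D → (∀ s ∈ D.support, SmallEval s (F s)) → SmallEval t (D.bind F)

/-- A term all of whose reduction paths end in a value. -/
def Halts (t : Tm) : Prop := ∃ D, SmallEval t D

theorem PMF.bind_congr_support {α β : Type*} (p : PMF α) {f g : α → PMF β}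
    (h : ∀ a ∈ p.support, f a = g a) : p.bind f = p.bind g := by
  ext b
  rw [PMF.bind_apply, PMF.bind_apply]
  refine tsum_congr fun a => ?_
  by_cases ha : p a = 0
  · simp [ha]
  · rw [h a ((p.mem_support_iff a).2 ha)]

theorem SmallEval.unique {t : Tm} {D E : PMF Tm} (h : SmallEval t D) (h' : SmallEval t E) :
    D = E := by
  induction h generalizing E with
  | val hv =>
    cases h' with
    | val => rfl
    | step hs _ => exact (not_step_of_isValue hv hs).elim
  | step hs _ ih =>
    cases h' with
    | val hv => exact (not_step_of_isValue hv hs).elim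
    | step hs' hF =>
      obtain rfl := hs.unique hs'
      exact PMF.bind_congr_support _ fun a ha => ih a ha (hF a ha)

theorem Halts.of_step {t : Tm} {D : PMF Tm} (hs : Step t D) (h : ∀ s ∈ D.support, Halts s) :
    Halts t := by
  choose! F hF using h
  exact ⟨_, .step hs hF⟩

theorem Halts.step {t s : Tm} {D : PMF Tm} (h : Halts t) (hs : Step t D) (hm : s ∈ D.support) :
    Halts s := by
  obtain ⟨E, hE⟩ := h
  cases hE with
  | val hv => exact (not_step_of_isValue hv hs).elim
  | step hs' hF =>
    obtain rfl := hs.unique hs'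
    exact ⟨_, hF s hm⟩

theorem Halts.exists_step {t : Tm} (h : Halts t) (hv : ¬ IsValue t) : ∃ D, Step t D := by
  obtain ⟨E, hE⟩ := h
  cases hE with
  | val hv' => exact (hv hv').elim
  | step hs _ => exact ⟨_, hs⟩

/-- The value distribution of a halting term. -/
noncomputable def smallSem (t : Tm) : PMF Tm :=
  if h : Halts t then h.choose else PMF.pure t

theorem smallEval_smallSem {t : Tm} (h : Halts t) : SmallEval t (smallSem t) := by
  rw [smallSem, dif_pos h]
  exact h.choose_spec

theorem smallSem_of_isValue {v : Tm} (hv : IsValue v) : smallSem v = PMF.pure v :=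
  (smallEval_smallSem ⟨_, .val hv⟩).unique (.val hv)

theorem smallSem_of_step {t : Tm} {D : PMF Tm} (hs : Step t D) (h : ∀ s ∈ D.support, Halts s) :
    smallSem t = D.bind smallSem :=
  (smallEval_smallSem (.of_step hs h)).unique (.step hs fun s hm => smallEval_smallSem (h s hm))

/-- `s` is a one-step reduct of the halting term `t`. -/
def HaltRed (s t : Tm) : Prop := ∃ D, Step t D ∧ s ∈ D.support ∧ Halts t

theorem wellFounded_haltRed : WellFounded HaltRed := by
  have key : ∀ t D, SmallEval t D → Acc HaltRed t := by
    intro t D h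
    induction h with
    | val hv => exact ⟨_, fun s ⟨_, hs, _⟩ => (not_step_of_isValue hv hs).elim⟩
    | step hs _ ih =>
      refine ⟨_, fun s ⟨D', hs', hm, _⟩ => ?_⟩
      obtain rfl := hs.unique hs'
      exact ih s hm
  refine ⟨fun t => ⟨_, fun s ⟨D, hs, hm, ht⟩ => ?_⟩⟩
  obtain ⟨E, hE⟩ := ht.step hs hm
  exact key s E hE

/-! ### Normalization of term distributions -/

/-- A term distribution supported on values. -/
def IsValD (T : PMF Tm) : Prop := ∀ t ∈ T.support, IsValue t

theorem IsLamD.isValD {T : PMF Tm} (h : IsLamD T) : IsValD T := fun t ht => by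
  obtain ⟨x, a, A, b, rfl⟩ := h t ht
  trivial

theorem IsStrD.isValD {T : PMF Tm} (h : IsStrD T) : IsValD T := fun t ht => by
  obtain ⟨m, rfl⟩ := h t ht
  trivial

/-- Term distributions that reach a value distribution in finitely many reduction steps. -/
def Normalizing (T : PMF Tm) : Prop :=
  {t ∈ T.support | ¬ IsValue t}.Finite ∧ ∀ t ∈ T.support, Halts t

theorem IsValD.normalizing {T : PMF Tm} (h : IsValD T) : Normalizing T := by
  refine ⟨Set.finite_empty.subset fun t ht => ht.2 (h t ht.1), fun t ht => ⟨_, .val (h t ht)⟩⟩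

theorem IsValD.bind_smallSem {T : PMF Tm} (h : IsValD T) : T.bind smallSem = T :=
  (T.bind_congr_support fun t ht => smallSem_of_isValue (h t ht)).trans T.bind_pure

theorem mem_support_reduce {T D : PMF Tm} {t : Tm} (ht : t ∈ T.support) (s : Tm) :
    s ∈ (T.bind fun u => if u = t then D else PMF.pure u).support ↔
      s ∈ D.support ∨ (s ∈ T.support ∧ s ≠ t) := by
  rw [PMF.mem_support_bind_iff]
  constructor
  · rintro ⟨u, hu, hs⟩
    by_cases h : u = t
    · rw [if_pos h] at hs
      exact .inl hs
    · rw [if_neg h, PMF.mem_support_pure_iff] at hs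
      exact .inr ⟨hs ▸ hu, hs ▸ h⟩
  · rintro (hs | ⟨hs, hne⟩)
    · exact ⟨t, ht, by rwa [if_pos rfl]⟩
    · exact ⟨s, hs, by rw [if_neg hne, PMF.mem_support_pure_iff]⟩

theorem bind_smallSem_reduce {T D : PMF Tm} {t : Tm} (h : smallSem t = D.bind smallSem) :
    (T.bind fun u => if u = t then D else PMF.pure u).bind smallSem = T.bind smallSem := by
  rw [PMF.bind_bind]
  congr 1
  funext u
  split_ifs with hu
  · rw [hu, h]
  · rw [PMF.pure_bind]

theorem Normalizing.of_intStep {T T' : PMF Tm} (h : IntStep T T') (hT' : Normalizing T') :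
    Normalizing T ∧ T'.bind smallSem = T.bind smallSem := by
  obtain ⟨t, ht, D, hs, rfl⟩ := h
  have hD : ∀ s ∈ D.support, Halts s := fun s hm => hT'.2 s ((mem_support_reduce ht s).2 (.inl hm))
  refine ⟨⟨(hT'.1.insert t).subset fun s hm => ?_, fun s hm => ?_⟩,
    bind_smallSem_reduce (smallSem_of_step hs hD)⟩
  · by_cases h : s = t
    · exact .inl h
    · exact .inr ⟨(mem_support_reduce ht s).2 (.inr ⟨hm.1, h⟩), hm.2⟩
  · by_cases h : s = t
    · exact h ▸ .of_step hs hD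
    · exact hT'.2 s ((mem_support_reduce ht s).2 (.inr ⟨hm, h⟩))

theorem Normalizing.intStep {T T' : PMF Tm} (hT : Normalizing T) (h : IntStep T T') :
    Normalizing T' := by
  obtain ⟨t, ht, D, hs, rfl⟩ := h
  refine ⟨(hs.finite_support.union hT.1).subset fun s hm => ?_, fun s hm => ?_⟩
  · rcases (mem_support_reduce ht s).1 hm.1 with h | h
    · exact .inl h
    · exact .inr ⟨h.1, hm.2⟩
  · rcases (mem_support_reduce ht s).1 hm with h | h
    · exact (hT.2 t ht).step hs h
    · exact hT.2 s h.1

theorem normalizing_of_reduces {T N : PMF Tm} (h : Relation.ReflTransGen IntStep T N)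
    (hN : IsValD N) : Normalizing T ∧ N = T.bind smallSem := by
  induction h using Relation.ReflTransGen.head_induction_on with
  | refl => exact ⟨hN.normalizing, hN.bind_smallSem.symm⟩
  | head h _ ih =>
    obtain ⟨h1, h2⟩ := Normalizing.of_intStep h ih.1
    exact ⟨h1, ih.2.trans h2⟩

theorem reduces_unique {T N N' : PMF Tm} (h : Relation.ReflTransGen IntStep T N) (hN : IsValD N)
    (h' : Relation.ReflTransGen IntStep T N') (hN' : IsValD N') : N = N' :=
  (normalizing_of_reduces h hN).2.trans (normalizing_of_reduces h' hN').2.symm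

theorem exists_reduces_isValD (M : Multiset Tm) (T : PMF Tm) (hT : ∀ t ∈ T.support, Halts t)
    (hM : ∀ t ∈ T.support, ¬ IsValue t → t ∈ M) :
    ∃ N, Relation.ReflTransGen IntStep T N ∧ IsValD N := by
  have : Std.Irrefl HaltRed := ⟨fun t => wellFounded_haltRed.irrefl.irrefl t⟩
  induction M using wellFounded_haltRed.cutExpand.induction generalizing T with
  | _ M ih =>
  by_cases hv : IsValD T
  · exact ⟨T, .refl, hv⟩
  simp only [IsValD, not_forall] at hv
  obtain ⟨t, ht, hv⟩ := hv
  obtain ⟨D, hs⟩ := (hT t ht).exists_step hv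
  obtain ⟨N, hN, hNv⟩ := ih (M.erase t + hs.finite_support.toFinset.val)
    ⟨hs.finite_support.toFinset.val, t,
      fun s hm => ⟨D, hs, by simpa using hm, hT t ht⟩, by
        rw [add_right_comm, add_comm (M.erase t), Multiset.singleton_add,
          Multiset.cons_erase (hM t ht hv)]⟩
    (T.bind fun u => if u = t then D else PMF.pure u)
    (fun s hm => by
      rcases (mem_support_reduce ht s).1 hm with h | h
      · exact (hT t ht).step hs h
      · exact hT s h.1)
    (fun s hm hsv => by
      rw [Multiset.mem_add]
      rcases (mem_support_reduce ht s).1 hm with h | h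
      · exact .inr (by simpa using h)
      · exact .inl ((Multiset.mem_erase_of_ne h.2).2 (hM s h.1 hsv)))
  exact ⟨N, .head ⟨t, ht, D, hs, rfl⟩ hN, hNv⟩

theorem reduces_of_intStep {T T' N : PMF Tm} (hTT' : IntStep T T')
    (h : Relation.ReflTransGen IntStep T N) (hN : IsValD N) :
    Relation.ReflTransGen IntStep T' N := by
  have hT' := (normalizing_of_reduces h hN).1.intStep hTT'
  obtain ⟨N', h', hN'⟩ := exists_reduces_isValD hT'.1.toFinset.val T' hT'.2
    fun t ht hv => by simpa using ⟨(T'.mem_support_iff t).1 ht, hv⟩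
  rwa [reduces_unique h hN (h'.head hTT') hN']

/-! ### Decomposition of labeled reduction and acceptance -/

theorem traceStep_of_reduces {T N U : PMF Tm} {S : Trace}
    (h : Relation.ReflTransGen IntStep T N) (h' : TraceStep N S U) : TraceStep T S U := by
  induction h' with
  | refl =>
    induction h with
    | refl => exact .refl _
    | tail _ hs ih => exact ih.internal hs
  | internal _ hs ih => exact ih.internal hs
  | pass _ hl ih => exact ih.pass hl

theorem traceStep_pass_cons {N U : PMF Tm} {v : Tm} {S : Trace} (hN : IsLamD N)
    (h : TraceStep (N.map (applyLam v)) S U) : TraceStep N (Act.pass v :: S) U := by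
  generalize hM : N.map (applyLam v) = M at h
  induction h with
  | refl =>
    subst hM
    exact TraceStep.pass (S := []) (.refl N) hN
  | internal _ hs ih => exact ih.internal hs
  | pass _ hl ih => exact TraceStep.pass ih hl

theorem traceStep_decompose {T U : PMF Tm} {S : Trace} (h : TraceStep T S U) :
    (S = [] ∧ Relation.ReflTransGen IntStep T U) ∨
      ∃ v S' N, S = Act.pass v :: S' ∧ Relation.ReflTransGen IntStep T N ∧ IsLamD N ∧
        TraceStep (N.map (applyLam v)) S' U := by
  induction h with
  | refl => exact .inl ⟨rfl, .refl⟩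
  | internal _ hs ih =>
    rcases ih with ⟨rfl, h⟩ | ⟨v, S', N, rfl, hN, hl, h⟩
    · exact .inl ⟨rfl, h.tail hs⟩
    · exact .inr ⟨v, S', N, rfl, hN, hl, h.internal hs⟩
  | pass _ hl ih =>
    rcases ih with ⟨rfl, h⟩ | ⟨v, S', N, rfl, hN, hl', h⟩
    · exact .inr ⟨_, [], _, rfl, h, hl, .refl _⟩
    · exact .inr ⟨v, _, N, rfl, hN, hl', h.pass hl⟩

theorem TraceAcc.exists_traceStep {T : PMF Tm} {tr : Trace} {p : ℝ} (h : TraceAcc T tr p) :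
    ∃ S N m, tr = S ++ [Act.view m] ∧ TraceStep T S N ∧ IsStrD N ∧
      p = (N (Tm.str m)).toReal := by
  cases h with
  | view h hN => exact ⟨_, _, _, rfl, h, hN, rfl⟩

theorem traceAcc_view_iff {T : PMF Tm} {m : BStr} {p : ℝ} :
    TraceAcc T [Act.view m] p ↔
      ∃ N, Relation.ReflTransGen IntStep T N ∧ IsStrD N ∧ p = (N (Tm.str m)).toReal := by
  constructor
  · intro hp
    obtain ⟨S, N, m', htr, h, hN, rfl⟩ := hp.exists_traceStep
    obtain ⟨rfl, hm⟩ : S = [] ∧ m = m' := by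
      cases S <;> simp_all
    rcases traceStep_decompose h with ⟨-, h⟩ | ⟨_, _, _, h, _⟩
    · exact ⟨N, h, hN, by rw [hm]⟩
    · cases h
  · rintro ⟨N, h, hN, rfl⟩
    exact TraceAcc.view (S := []) (traceStep_of_reduces h (.refl N)) hN

theorem traceAcc_pass_iff {T : PMF Tm} {v : Tm} {tr : Trace} {p : ℝ} :
    TraceAcc T (Act.pass v :: tr) p ↔
      ∃ N, Relation.ReflTransGen IntStep T N ∧ IsLamD N ∧
        TraceAcc (N.map (applyLam v)) tr p := by
  constructor
  · intro hp
    obtain ⟨S, U, m, htr, h, hU, rfl⟩ := hp.exists_traceStep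
    rcases traceStep_decompose h with ⟨rfl, -⟩ | ⟨w, S', N, rfl, hN, hl, h⟩
    · simp at htr
    · simp only [List.cons_append, List.cons.injEq, Act.pass.injEq] at htr
      obtain ⟨rfl, rfl⟩ := htr
      exact ⟨N, hN, hl, .view h hU⟩
  · rintro ⟨N, hN, hl, hp⟩
    obtain ⟨S, U, m, rfl, h, hU, rfl⟩ := hp.exists_traceStep
    exact TraceAcc.view (traceStep_of_reduces hN (traceStep_pass_cons hl h)) hU

theorem not_traceAcc_nil {T : PMF Tm} {p : ℝ} : ¬ TraceAcc T [] p := by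
  intro h
  obtain ⟨S, N, m, htr, -⟩ := h.exists_traceStep
  simp at htr

theorem eq_nil_of_traceAcc_view_cons {T : PMF Tm} {m : BStr} {tr : Trace} {p : ℝ}
    (h : TraceAcc T (Act.view m :: tr) p) : tr = [] := by
  obtain ⟨S, N, m', htr, h, -⟩ := h.exists_traceStep
  rcases traceStep_decompose h with ⟨rfl, -⟩ | ⟨_, _, _, rfl, _⟩ <;> simp_all

theorem TraceAcc.unique {T : PMF Tm} {tr : Trace} {p q : ℝ} (hp : TraceAcc T tr p)
    (hq : TraceAcc T tr q) : p = q := by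
  induction tr generalizing T with
  | nil => exact (not_traceAcc_nil hp).elim
  | cons a tr ih =>
    cases a with
    | pass v =>
      obtain ⟨N, hN, hl, hp⟩ := traceAcc_pass_iff.1 hp
      obtain ⟨N', hN', hl', hq⟩ := traceAcc_pass_iff.1 hq
      obtain rfl := reduces_unique hN hl.isValD hN' hl'.isValD
      exact ih hp hq
    | view m =>
      obtain rfl := eq_nil_of_traceAcc_view_cons hp
      obtain ⟨N, hN, hs, rfl⟩ := traceAcc_view_iff.1 hp
      obtain ⟨N', hN', hs', rfl⟩ := traceAcc_view_iff.1 hq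
      rw [reduces_unique hN hs.isValD hN' hs'.isValD]

theorem TraceAcc.prT_eq {T : PMF Tm} {tr : Trace} {p : ℝ} (h : TraceAcc T tr p) :
    prT T tr = p := by
  have hex : ∃ p, TraceAcc T tr p := ⟨p, h⟩
  rw [prT, dif_pos hex]
  exact hex.choose_spec.unique h

theorem traceAcc_of_prT_ne_zero {T : PMF Tm} {tr : Trace} (h : prT T tr ≠ 0) :
    ∃ p, TraceAcc T tr p := by
  by_contra hex
  exact h (by rw [prT, dif_neg hex])

theorem prT_congr {T T' : PMF Tm} {tr tr' : Trace}
    (h : ∀ p, TraceAcc T tr p ↔ TraceAcc T' tr' p) : prT T tr = prT T' tr' := by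
  have : TraceAcc T tr = TraceAcc T' tr' := funext fun p => propext (h p)
  simp only [prT, this]

theorem traceAcc_iff_of_intStep {T T' : PMF Tm} (h : IntStep T T') (tr : Trace) (p : ℝ) :
    TraceAcc T' tr p ↔ TraceAcc T tr p := by
  cases tr with
  | nil => simp only [not_traceAcc_nil]
  | cons a tr =>
    cases a with
    | pass v =>
      rw [traceAcc_pass_iff, traceAcc_pass_iff]
      exact ⟨fun ⟨N, hN, hl, hp⟩ => ⟨N, hN.head h, hl, hp⟩,
        fun ⟨N, hN, hl, hp⟩ => ⟨N, reduces_of_intStep h hN hl.isValD, hl, hp⟩⟩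
    | view m =>
      refine ⟨fun hp => ?_, fun hp => ?_⟩ <;>
        obtain rfl := eq_nil_of_traceAcc_view_cons hp <;>
        obtain ⟨N, hN, hs, hp⟩ := traceAcc_view_iff.1 hp
      · exact traceAcc_view_iff.2 ⟨N, hN.head h, hs, hp⟩
      · exact traceAcc_view_iff.2 ⟨N, reduces_of_intStep h hN hs.isValD, hs, hp⟩

theorem trEq_of_intStep {T T' : PMF Tm} (h : IntStep T T') : TrEq T' T := fun tr =>
  prT_congr (traceAcc_iff_of_intStep h tr)

theorem trEq_of_reduces {T T' : PMF Tm} (h : Relation.ReflTransGen IntStep T T') :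
    TrEq T' T := by
  induction h with
  | refl => exact fun _ => rfl
  | tail _ hs ih => exact fun tr => (trEq_of_intStep hs tr).trans (ih tr)

theorem prT_of_traceStep_pass {T T' : PMF Tm} {v : Tm} (h : TraceStep T [Act.pass v] T')
    (tr : Trace) : prT T' tr = prT T (Act.pass v :: tr) := by
  rcases traceStep_decompose h with ⟨h, -⟩ | ⟨w, S', N, hS, hN, hl, h⟩
  · cases h
  · simp only [List.cons.injEq, Act.pass.injEq] at hS
    obtain ⟨rfl, rfl⟩ := hS
    rcases traceStep_decompose h with ⟨-, h⟩ | ⟨_, _, _, h, _⟩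
    · rw [trEq_of_reduces h tr]
      refine prT_congr fun p => ⟨fun hp => traceAcc_pass_iff.2 ⟨N, hN, hl, hp⟩, fun hp => ?_⟩
      obtain ⟨N', hN', hl', hp⟩ := traceAcc_pass_iff.1 hp
      rwa [reduces_unique hN hl.isValD hN' hl'.isValD]
    · cases h

theorem IsStrD.exists_toReal_ne_zero {T : PMF Tm} (h : IsStrD T) :
    ∃ m : BStr, (T (Tm.str m)).toReal ≠ 0 := by
  obtain ⟨t, ht⟩ := T.support_nonempty
  obtain ⟨m, rfl⟩ := h t ht
  exact ⟨m, ENNReal.toReal_ne_zero.2 ⟨(T.mem_support_iff _).1 ht, T.apply_ne_top _⟩⟩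

/-- Properties of trace equivalence: it is preserved by internal
reduction and by `pass`-actions, and trace-equivalent distributions accept every
`view`-action with the same probability. -/
theorem stmt2 (T S : PMF Tm) (h : TrEq T S) :
    (∀ T' : PMF Tm, IntStep T T' → TrEq T' S) ∧
      (∀ (v : Tm) (T' S' : PMF Tm),
        TraceStep T [Act.pass v] T' → TraceStep S [Act.pass v] S' → TrEq T' S') ∧
      (∀ (m : BStr) (p : ℝ), TraceAcc T [Act.view m] p → TraceAcc S [Act.view m] p) := by
  refine ⟨fun T' hT' tr => (trEq_of_intStep hT' tr).trans (h tr), fun v T' S' hT' hS' tr => ?_,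
    fun m p hp => ?_⟩
  · rw [prT_of_traceStep_pass hT', prT_of_traceStep_pass hS', h]
  · obtain ⟨N, hN, hs, -⟩ := traceAcc_view_iff.1 hp
    obtain ⟨m', hm'⟩ := hs.exists_toReal_ne_zero
    have hacc : TraceAcc T [Act.view m'] _ := traceAcc_view_iff.2 ⟨N, hN, hs, rfl⟩
    rw [← hacc.prT_eq, h] at hm'
    obtain ⟨q, hq⟩ := traceAcc_of_prT_ne_zero hm'
    obtain ⟨K, hK, hKs, -⟩ := traceAcc_view_iff.1 hq
    have haccS : TraceAcc S [Act.view m] _ := traceAcc_view_iff.2 ⟨K, hK, hKs, rfl⟩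
    rwa [← hp.prT_eq, h, haccS.prT_eq]
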